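/- Let A_1, …, A_n (n ≥ 1) be complex hermitian positive-semidefinite m×m matrices, and assume that some real linear combination of A_1, …, A_n has rank m. Define P(x_1, …, x_n) = det(Σ_{i=1}^n x_i A_i) for real x_1, …, x_n (this is a real number). Then P is strictly positive on (0,∞)^n, and P^{-β} is completely monotone on (0,∞)^n for every β ∈ {0, 1, 2, 3, …} and for every real β ≥ m−1. -/

import Mathlib

open scoped ComplexOrder

/-- The open positive orthant `(0,∞)^ι`. -/
def posOrthant (ι : Type*) : Set (ι → ℝ) := {x | ∀ i, 0 < x i}

/-- A function `f : (0,∞)^ι → ℝ` is completely monotone if it is `C^∞` on the open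
orthant and `(−1)^k ∂^k f/(∂x_{i_1}···∂x_{i_k}) ≥ 0` there, for every `k ≥ 0` and all
indices `i_1, …, i_k`. -/
def CompletelyMonotoneOnOrthant {ι : Type*} [Fintype ι] [DecidableEq ι]
    (f : (ι → ℝ) → ℝ) : Prop :=
  ContDiffOn ℝ (⊤ : ℕ∞) f (posOrthant ι) ∧
    ∀ (k : ℕ) (idx : Fin k → ι), ∀ x ∈ posOrthant ι,
      0 ≤ (-1 : ℝ) ^ k *
        iteratedFDerivWithin ℝ k f (posOrthant ι) x (fun j => Pi.single (idx j) (1 : ℝ))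

open MeasureTheory Real

/-- `f` is on the open orthant the Laplace transform of the measure `μ`, which is carried by the
closed orthant. -/
def IsLaplaceTransform {ι : Type*} [Fintype ι] (μ : Measure (ι → ℝ)) (f : (ι → ℝ) → ℝ) : Prop :=
  (∀ᵐ t ∂μ, ∀ i, 0 ≤ t i) ∧ ∀ x ∈ posOrthant ι,
    Integrable (fun t => exp (-(x ⬝ᵥ t))) μ ∧ f x = ∫ t, exp (-(x ⬝ᵥ t)) ∂μ

theorem isOpen_posOrthant (ι : Type*) [Finite ι] : IsOpen (posOrthant ι) := by
  have : posOrthant ι = ⋂ i, {x : ι → ℝ | 0 < x i} := by ext; simp [posOrthant]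
  rw [this]
  exact isOpen_iInter_of_finite fun i => isOpen_lt continuous_const (continuous_apply i)

theorem smul_mem_posOrthant {ι : Type*} {x : ι → ℝ} {c : ℝ} (hc : 0 < c)
    (hx : x ∈ posOrthant ι) : c • x ∈ posOrthant ι := fun i => mul_pos hc (hx i)

namespace IsLaplaceTransform

variable {ι : Type*} [Fintype ι] {μ : Measure (ι → ℝ)} {f : (ι → ℝ) → ℝ}

theorem coord_le_mul_exp {x t : ι → ℝ} (hx : x ∈ posOrthant ι) (ht : ∀ i, 0 ≤ t i) (i : ι) :
    t i ≤ (x i)⁻¹ * exp (x ⬝ᵥ t) := by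
  have h1 : x i * t i ≤ x ⬝ᵥ t :=
    Finset.single_le_sum (f := fun j => x j * t j) (fun j _ => mul_nonneg (hx j).le (ht j))
      (Finset.mem_univ i)
  have h2 := add_one_le_exp (x ⬝ᵥ t)
  rw [le_inv_mul_iff₀ (hx i)]
  linarith

theorem exp_mul_coord_le {x y t : ι → ℝ} (hx : x ∈ posOrthant ι) (ht : ∀ i, 0 ≤ t i)
    (hy : ∀ i, x i / 2 ≤ y i) (i : ι) :
    exp (-(y ⬝ᵥ t)) * t i ≤ (x i / 4)⁻¹ * exp (-(((4 : ℝ)⁻¹ • x) ⬝ᵥ t)) := by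
  have hx4 : (4 : ℝ)⁻¹ • x ∈ posOrthant ι := smul_mem_posOrthant (by norm_num) hx
  have h1 := coord_le_mul_exp hx4 ht i
  have h2 : 2 * (((4 : ℝ)⁻¹ • x) ⬝ᵥ t) ≤ y ⬝ᵥ t := by
    simp only [dotProduct, Finset.mul_sum]
    refine Finset.sum_le_sum fun j _ => ?_
    have := mul_le_mul_of_nonneg_right (hy j) (ht j)
    simp only [Pi.smul_apply, smul_eq_mul]
    linarith
  have h3 : ((4 : ℝ)⁻¹ • x) i = x i / 4 := by simp; ring
  rw [h3] at h1
  have h4 : 0 < x i := hx i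
  calc exp (-(y ⬝ᵥ t)) * t i
      ≤ exp (-(2 * (((4 : ℝ)⁻¹ • x) ⬝ᵥ t))) * ((x i / 4)⁻¹ * exp (((4 : ℝ)⁻¹ • x) ⬝ᵥ t)) := by
        gcongr
        exact ht i
    _ = _ := by
        rw [mul_left_comm, ← exp_add]
        ring_nf

theorem integrable_exp_mul_coord (h : IsLaplaceTransform μ f) {x : ι → ℝ}
    (hx : x ∈ posOrthant ι) (i : ι) : Integrable (fun t => exp (-(x ⬝ᵥ t)) * t i) μ := by
  have hx4 : (4 : ℝ)⁻¹ • x ∈ posOrthant ι := smul_mem_posOrthant (by norm_num) hx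
  refine ((h.2 _ hx4).1.const_mul (x i / 4)⁻¹).mono' ?_ ?_
  · exact Measurable.aestronglyMeasurable (by unfold dotProduct; fun_prop)
  · filter_upwards [h.1] with t ht
    rw [Real.norm_of_nonneg (mul_nonneg (exp_pos _).le (ht i))]
    exact exp_mul_coord_le hx ht (fun j => by have := hx j; linarith) i

theorem withDensity_coord (h : IsLaplaceTransform μ f) (i : ι) :
    IsLaplaceTransform (μ.withDensity fun t => ENNReal.ofReal (t i))
      (fun x => ∫ t, exp (-(x ⬝ᵥ t)) * t i ∂μ) := by
  have key : ∀ x : ι → ℝ, (fun t : ι → ℝ => (ENNReal.ofReal (t i)).toReal • exp (-(x ⬝ᵥ t)))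
      =ᵐ[μ] fun t => exp (-(x ⬝ᵥ t)) * t i := fun x => by
    filter_upwards [h.1] with t ht
    rw [ENNReal.toReal_ofReal (ht i), smul_eq_mul, mul_comm]
  have hm : Measurable fun t : ι → ℝ => ENNReal.ofReal (t i) := by fun_prop
  refine ⟨(withDensity_absolutelyContinuous _ _).ae_le h.1, fun x hx => ⟨?_, ?_⟩⟩
  · rw [integrable_withDensity_iff_integrable_smul' hm (by simp)]
    exact (h.integrable_exp_mul_coord hx i).congr (key x).symm
  · rw [integral_withDensity_eq_integral_toReal_smul hm (by simp)]
    exact integral_congr_ae (key x).symm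

theorem hasFDerivAt (h : IsLaplaceTransform μ f) {x : ι → ℝ} (hx : x ∈ posOrthant ι) :
    HasFDerivAt f (∑ i, (-∫ t, exp (-(x ⬝ᵥ t)) * t i ∂μ) •
      ContinuousLinearMap.proj (R := ℝ) (φ := fun _ : ι => ℝ) i) x := by
  let F' : (ι → ℝ) → (ι → ℝ) → (ι → ℝ) →L[ℝ] ℝ := fun y t =>
    ∑ i, (-(exp (-(y ⬝ᵥ t)) * t i)) • ContinuousLinearMap.proj (R := ℝ) (φ := fun _ : ι => ℝ) i
  have hF'int : ∫ t, F' x t ∂μ = ∑ i, (-∫ t, exp (-(x ⬝ᵥ t)) * t i ∂μ) •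
      ContinuousLinearMap.proj (R := ℝ) (φ := fun _ : ι => ℝ) i := by
    rw [integral_finsetSum]
    · refine Finset.sum_congr rfl fun i _ => ?_
      rw [integral_smul_const, integral_neg]
    · exact fun i _ => (h.integrable_exp_mul_coord hx i).neg.smul_const _
  have hx4 : (4 : ℝ)⁻¹ • x ∈ posOrthant ι := smul_mem_posOrthant (by norm_num) hx
  have hs : {y : ι → ℝ | ∀ i, x i / 2 < y i} ∈ nhds x := by
    have : {y : ι → ℝ | ∀ i, x i / 2 < y i} = ⋂ i, {y : ι → ℝ | x i / 2 < y i} := by ext; simp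
    rw [this]
    refine (isOpen_iInter_of_finite fun i => isOpen_lt continuous_const
      (continuous_apply i)).mem_nhds ?_
    simp only [Set.mem_iInter, Set.mem_ofPred_eq]
    exact fun i => by have := hx i; linarith
  have main : HasFDerivAt (fun y => ∫ t, exp (-(y ⬝ᵥ t)) ∂μ) (∫ t, F' x t ∂μ) x := by
    refine hasFDerivAt_integral_of_dominated_of_fderiv_le (bound := fun t => ∑ i,
      (x i / 4)⁻¹ * exp (-(((4 : ℝ)⁻¹ • x) ⬝ᵥ t)) *
        ‖ContinuousLinearMap.proj (R := ℝ) (φ := fun _ : ι => ℝ) i‖) hs ?_ (h.2 x hx).1 ?_ ?_ ?_ ?_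
    · exact .of_forall fun y => Measurable.aestronglyMeasurable (by unfold dotProduct; fun_prop)
    · refine Finset.aestronglyMeasurable_fun_sum _ fun i _ => ?_
      exact (h.integrable_exp_mul_coord hx i).neg.aestronglyMeasurable.smul_const _
    · filter_upwards [h.1] with t ht y hy
      refine (norm_sum_le _ _).trans (Finset.sum_le_sum fun i _ => ?_)
      rw [norm_smul, norm_neg, Real.norm_of_nonneg (mul_nonneg (exp_pos _).le (ht i))]
      exact mul_le_mul_of_nonneg_right (exp_mul_coord_le hx ht (fun j => (hy j).le) i)
        (norm_nonneg _)
    · exact integrable_finsetSum _ fun i _ => ((h.2 _ hx4).1.const_mul _).mul_const _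
    · refine .of_forall fun t y _ => ?_
      have h1 : HasFDerivAt (fun y : ι → ℝ => -(y ⬝ᵥ t))
          (-∑ i, t i • ContinuousLinearMap.proj (R := ℝ) (φ := fun _ : ι => ℝ) i) y := by
        refine HasFDerivAt.neg (HasFDerivAt.fun_sum fun i _ => ?_)
        exact ((ContinuousLinearMap.proj (R := ℝ) (φ := fun _ : ι => ℝ) i).hasFDerivAt).mul_const _
      refine h1.exp.congr_fderiv ?_
      simp only [F', smul_neg, Finset.smul_sum, smul_smul]
      rw [← Finset.sum_neg_distrib]
      exact Finset.sum_congr rfl fun i _ => (neg_smul _ _).symm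
  rw [← hF'int]
  refine main.congr_of_eventuallyEq ?_
  filter_upwards [(isOpen_posOrthant ι).mem_nhds hx] with y hy using (h.2 y hy).2

theorem contDiffOn (h : IsLaplaceTransform μ f) :
    ContDiffOn ℝ (⊤ : ℕ∞) f (posOrthant ι) := by
  refine contDiffOn_infty.2 fun n => ?_
  induction n generalizing μ f with
  | zero =>
    exact contDiffOn_zero.2 fun x hx => (h.hasFDerivAt hx).continuousAt.continuousWithinAt
  | succ n ih =>
    push_cast
    refine contDiffOn_succ_of_fderivWithin
      (fun x hx => (h.hasFDerivAt hx).differentiableAt.differentiableWithinAt) (fun hn => absurd hn (by simp)) ?_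
    refine ContDiffOn.congr (f := fun x => ∑ i, (-∫ t, exp (-(x ⬝ᵥ t)) * t i ∂μ) •
      ContinuousLinearMap.proj (R := ℝ) (φ := fun _ : ι => ℝ) i) ?_ fun x hx => ?_
    · exact ContDiffOn.sum fun i _ => (ih (h.withDensity_coord i)).neg.smul contDiffOn_const
    · exact (h.hasFDerivAt hx).hasFDerivWithinAt.fderivWithin
        ((isOpen_posOrthant ι).uniqueDiffWithinAt hx)

theorem iteratedFDerivWithin_sign [DecidableEq ι] (h : IsLaplaceTransform μ f) (k : ℕ)
    (idx : Fin k → ι) {x : ι → ℝ} (hx : x ∈ posOrthant ι) :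
    0 ≤ (-1 : ℝ) ^ k *
      iteratedFDerivWithin ℝ k f (posOrthant ι) x (fun j => Pi.single (idx j) (1 : ℝ)) := by
  induction k generalizing μ f with
  | zero =>
    simp only [pow_zero, one_mul, iteratedFDerivWithin_zero_apply]
    rw [(h.2 x hx).2]
    exact integral_nonneg fun t => (exp_pos _).le
  | succ k ih =>
    have hu : UniqueDiffOn ℝ (posOrthant ι) := (isOpen_posOrthant ι).uniqueDiffOn
    have hd := h.withDensity_coord (idx (Fin.last k))
    have hcd : ContDiffOn ℝ k (fderivWithin ℝ f (posOrthant ι)) (posOrthant ι) :=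
      (h.contDiffOn.fderivWithin hu (m := (⊤ : ℕ∞)) (by simp)).of_le (by exact_mod_cast le_top)
    let E : ((ι → ℝ) →L[ℝ] ℝ) →L[ℝ] ℝ :=
      ContinuousLinearMap.apply ℝ ℝ (E := ι → ℝ) (Pi.single (idx (Fin.last k)) 1)
    have hcomp := E.iteratedFDerivWithin_comp_left (n := (k : WithTop ℕ∞)) (hcd x hx) hu hx le_rfl
    have hcongr : iteratedFDerivWithin ℝ k (E ∘ fderivWithin ℝ f (posOrthant ι))
          (posOrthant ι) x =
        -iteratedFDerivWithin ℝ k (fun x => ∫ t, exp (-(x ⬝ᵥ t)) * t (idx (Fin.last k)) ∂μ)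
          (posOrthant ι) x := by
      rw [← iteratedFDerivWithin_neg_apply hu hx]
      refine iteratedFDerivWithin_congr (fun y hy => ?_) hx k
      rw [Function.comp_apply, (h.hasFDerivAt hy).hasFDerivWithinAt.fderivWithin
        ((isOpen_posOrthant ι).uniqueDiffWithinAt hy)]
      simp [E, Pi.single_apply]
    rw [hcongr] at hcomp
    rw [iteratedFDerivWithin_succ_apply_right hu hx]
    have hval := congrArg
      (fun M => M (fun j : Fin k => (Pi.single (idx j.castSucc) (1 : ℝ) : ι → ℝ))) hcomp
    have := ih hd fun j => idx j.castSucc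
    simp only [neg_apply,
      ContinuousLinearMap.compContinuousMultilinearMap_coe, Function.comp_apply,
      E, ContinuousLinearMap.apply_apply] at hval
    rw [show (Fin.init fun j : Fin (k + 1) => (Pi.single (idx j) (1 : ℝ) : ι → ℝ)) =
      fun j : Fin k => Pi.single (idx j.castSucc) (1 : ℝ) from rfl, ← hval, pow_succ]
    linarith

theorem completelyMonotone [DecidableEq ι] (h : IsLaplaceTransform μ f) :
    CompletelyMonotoneOnOrthant f :=
  ⟨h.contDiffOn, fun k idx _ hx => h.iteratedFDerivWithin_sign k idx hx⟩

end IsLaplaceTransform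

theorem IsLaplaceTransform.of_lintegral {ι : Type*} [Fintype ι] {μ : Measure (ι → ℝ)}
    {f : (ι → ℝ) → ℝ} (hμ : ∀ᵐ t ∂μ, ∀ i, 0 ≤ t i) (hf : ∀ x ∈ posOrthant ι, 0 ≤ f x)
    (h : ∀ x ∈ posOrthant ι, ∫⁻ t, ENNReal.ofReal (exp (-(x ⬝ᵥ t))) ∂μ = ENNReal.ofReal (f x)) :
    IsLaplaceTransform μ f := by
  refine ⟨hμ, fun x hx => ?_⟩
  have hm : AEStronglyMeasurable (fun t : ι → ℝ => exp (-(x ⬝ᵥ t))) μ :=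
    Measurable.aestronglyMeasurable (by unfold dotProduct; fun_prop)
  have h0 : 0 ≤ᵐ[μ] fun t : ι → ℝ => exp (-(x ⬝ᵥ t)) := .of_forall fun t => (exp_pos _).le
  refine ⟨⟨hm, ?_⟩, ?_⟩
  · rw [hasFiniteIntegral_iff_ofReal h0, h x hx]
    exact ENNReal.ofReal_lt_top
  · rw [integral_eq_lintegral_of_nonneg_ae h0 hm, h x hx, ENNReal.toReal_ofReal (hf x hx)]

theorem IsLaplaceTransform.lintegral_eq {ι : Type*} [Fintype ι] {μ : Measure (ι → ℝ)}
    {f : (ι → ℝ) → ℝ} (h : IsLaplaceTransform μ f) {x : ι → ℝ} (hx : x ∈ posOrthant ι) :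
    ∫⁻ t, ENNReal.ofReal (exp (-(x ⬝ᵥ t))) ∂μ = ENNReal.ofReal (f x) := by
  rw [(h.2 x hx).2, ofReal_integral_eq_lintegral_ofReal (h.2 x hx).1
    (.of_forall fun t => (exp_pos _).le)]

theorem isLaplaceTransform_dirac_zero {ι : Type*} [Fintype ι] :
    IsLaplaceTransform (Measure.dirac (0 : ι → ℝ)) fun _ => 1 := by
  refine .of_lintegral ?_ (fun _ _ => zero_le_one) fun x _ => ?_
  · exact (ae_dirac_iff (by measurability)).2 fun i => le_rfl
  · rw [lintegral_dirac' _ (by unfold dotProduct; fun_prop)]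
    simp

/-- The total mass of the standard Gaussian weight on `κ → ℂ`. -/
noncomputable def complexGaussianMass (κ : Type*) [Fintype κ] : ENNReal :=
  ∫⁻ z : κ → ℂ, ENNReal.ofReal (exp (-∑ i, ‖z i‖ ^ 2))

theorem complexGaussianMass_ne_zero (κ : Type*) [Fintype κ] : complexGaussianMass κ ≠ 0 := by
  rw [complexGaussianMass, Ne, lintegral_eq_zero_iff (by fun_prop)]
  intro h
  have : ∀ᵐ _ : κ → ℂ, False := by
    filter_upwards [h] with z hz
    simp only [Pi.zero_apply, ENNReal.ofReal_eq_zero] at hz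
    exact absurd (exp_pos _) (not_lt.2 hz)
  rw [ae_iff] at this
  exact isOpen_univ.measure_ne_zero volume Set.univ_nonempty (by simpa using this)

theorem complexGaussianMass_ne_top (κ : Type*) [Fintype κ] : complexGaussianMass κ ≠ ⊤ := by
  have h1 : Integrable fun z : ℂ => exp (-‖z‖ ^ 2) := by
    refine .of_integral_ne_zero ?_
    have := GaussianFourier.integral_rexp_neg_mul_sq_norm (V := ℂ) one_pos
    simp only [neg_mul, one_mul] at this
    rw [this]
    positivity
  have h2 := Integrable.fintype_prod (ι := κ) (f := fun _ z => exp (-‖z‖ ^ 2))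
    (μ := fun _ => (volume : Measure ℂ)) fun _ => h1
  rw [complexGaussianMass, ← lt_top_iff_ne_top]
  refine (lintegral_congr fun z => ?_).trans_lt h2.lintegral_lt_top
  rw [← Finset.sum_neg_distrib, exp_sum]

section Gaussian

open scoped MatrixOrder Matrix.Norms.L2Operator

theorem Matrix.PosSemidef.exists_eq_conjTranspose_mul_self {κ : Type*} [Fintype κ]
    {D : Matrix κ κ ℂ} (hD : D.PosSemidef) : ∃ M : Matrix κ κ ℂ, D = M.conjTranspose * M := by
  classical
  exact CStarAlgebra.nonneg_iff_eq_star_mul_self.mp hD.nonneg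

end Gaussian

open Matrix in
theorem lintegral_exp_neg_quadratic {κ : Type*} [Fintype κ] [DecidableEq κ] {D : Matrix κ κ ℂ}
    (hD : D.PosDef) :
    ∫⁻ z : κ → ℂ, ENNReal.ofReal (exp (-(star z ⬝ᵥ D *ᵥ z).re)) =
      ENNReal.ofReal D.det.re⁻¹ * complexGaussianMass κ := by
  obtain ⟨M, rfl⟩ := hD.posSemidef.exists_eq_conjTranspose_mul_self
  have hq : ∀ z, (star z ⬝ᵥ (Mᴴ * M) *ᵥ z).re = ∑ i, ‖(M *ᵥ z) i‖ ^ 2 := fun z => by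
    rw [← mulVec_mulVec, dotProduct_mulVec, vecMul_conjTranspose, star_star]
    simp [dotProduct, ← Complex.normSq_eq_norm_sq, Complex.normSq_apply]
  have hdet : (Mᴴ * M).det.re = ‖M.det‖ ^ 2 := by
    rw [det_mul, det_conjTranspose, ← Complex.normSq_eq_norm_sq]
    simp [Complex.normSq_apply]
  have hpos : 0 < (Mᴴ * M).det.re := (Complex.pos_iff.1 hD.det_pos).1
  have hlin : LinearMap.det ((M.toLin').restrictScalars ℝ) = ‖M.det‖ ^ 2 := by
    rw [LinearMap.det_restrictScalars, LinearMap.det_toLin', Algebra.norm_complex_apply,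
      Complex.normSq_eq_norm_sq]
  have hmap := Measure.map_linearMap_addHaar_eq_smul_addHaar (volume : Measure (κ → ℂ))
    (f := (M.toLin').restrictScalars ℝ) (by rw [hlin, ← hdet]; exact hpos.ne')
  have hmeas : Measurable ((M.toLin').restrictScalars ℝ) :=
    (LinearMap.continuous_of_finiteDimensional _).measurable
  calc _ = ∫⁻ z, ENNReal.ofReal (exp (-∑ i, ‖z i‖ ^ 2))
        ∂(Measure.map ((M.toLin').restrictScalars ℝ) volume) := by
        rw [lintegral_map (by fun_prop) hmeas]
        simp only [hq, LinearMap.coe_restrictScalars, toLin'_apply]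
    _ = _ := by
        rw [hmap, lintegral_smul_measure, hlin, ← hdet, abs_of_pos (inv_pos.2 hpos)]
        rfl

open Matrix in
theorem Matrix.PosDef.exists_schur {κ : Type*} [Fintype κ] [DecidableEq κ]
    {X : Matrix (Unit ⊕ κ) (Unit ⊕ κ) ℂ} (hX : X.PosDef) :
    ∃ σ : ℝ, 0 < σ ∧ ∃ c : κ → ℂ, X.det.re = X.toBlocks₂₂.det.re * σ ∧
      ∀ (r : ℝ) (z : κ → ℂ),
        (star (Sum.elim (fun _ : Unit => (r : ℂ)) z) ⬝ᵥ X *ᵥ Sum.elim (fun _ => (r : ℂ)) z).re =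
          (star (z + (r : ℂ) • c) ⬝ᵥ X.toBlocks₂₂ *ᵥ (z + (r : ℂ) • c)).re + r ^ 2 * σ := by
  have hD : X.toBlocks₂₂.PosDef := hX.submatrix Sum.inr_injective
  have hXb : X = fromBlocks X.toBlocks₁₁ X.toBlocks₁₂ X.toBlocks₁₂ᴴ X.toBlocks₂₂ := by
    conv_lhs => rw [← fromBlocks_toBlocks X]
    congr 1
    ext i j
    exact (hX.isHermitian.apply (Sum.inr i) (Sum.inl j)).symm
  let : Invertible X.toBlocks₂₂ := hD.isUnit.invertible
  set S := X.toBlocks₁₁ - X.toBlocks₁₂ * X.toBlocks₂₂⁻¹ * X.toBlocks₁₂ᴴ with hS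
  have hdet : X.det = X.toBlocks₂₂.det * S () () := by
    conv_lhs => rw [hXb, det_fromBlocks₂₂, invOf_eq_nonsing_inv, ← hS, det_unique S]; rfl
  have hdX := Complex.pos_iff.1 hX.det_pos
  have hdD := Complex.pos_iff.1 hD.det_pos
  have hre : X.det.re = X.toBlocks₂₂.det.re * (S () ()).re := by
    rw [hdet, Complex.mul_re, ← hdD.2]
    ring
  refine ⟨(S () ()).re, ?_, fun i => (X.toBlocks₂₂⁻¹ * X.toBlocks₁₂ᴴ) i (), hre, fun r z => ?_⟩
  · exact pos_of_mul_pos_right (hre ▸ hdX.1) hdD.1.le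
  · have h := schur_complement_eq₂₂ X.toBlocks₁₁ X.toBlocks₁₂ (fun _ : Unit => (r : ℂ)) z
      hD.isHermitian
    rw [← hXb, ← dotProduct_mulVec, ← dotProduct_mulVec, ← dotProduct_mulVec, ← hS] at h
    rw [h, Complex.add_re]
    have e1 : (X.toBlocks₂₂⁻¹ * X.toBlocks₁₂ᴴ) *ᵥ (fun _ : Unit => (r : ℂ)) + z =
        z + (r : ℂ) • fun i => (X.toBlocks₂₂⁻¹ * X.toBlocks₁₂ᴴ) i () := by
      ext i
      simp [mulVec, dotProduct, mul_comm, add_comm]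
    rw [e1]
    congr 1
    simp [mulVec, dotProduct]
    ring

theorem lintegral_rpow_mul_exp_neg_mul_Ioi {a r : ℝ} (ha : 0 < a) (hr : 0 < r) :
    ∫⁻ t in Set.Ioi 0, ENNReal.ofReal (t ^ (a - 1)) * ENNReal.ofReal (exp (-(r * t))) =
      ENNReal.ofReal (r ^ (-a)) * ENNReal.ofReal (Gamma a) := by
  have h := integral_rpow_mul_exp_neg_mul_Ioi ha hr
  have hpos : 0 < (1 / r) ^ a * Gamma a := by positivity
  rw [← ENNReal.ofReal_mul (by positivity), rpow_neg hr.le, ← inv_rpow hr.le, ← one_div, ← h,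
    ofReal_integral_eq_lintegral_ofReal (.of_integral_ne_zero (h ▸ hpos.ne'))]
  · refine setLIntegral_congr_fun measurableSet_Ioi fun t ht => ?_
    rw [ENNReal.ofReal_mul (rpow_nonneg (le_of_lt ht) _)]
  · filter_upwards [self_mem_ae_restrict measurableSet_Ioi] with t ht
    exact mul_nonneg (rpow_nonneg (le_of_lt ht) _) (exp_pos _).le

/-- The vector `(√s, z)` attached to a point `(s, z)`. -/
noncomputable def sqrtVec {κ : Type*} (p : ℝ × (κ → ℂ)) : Unit ⊕ κ → ℂ :=
  Sum.elim (fun _ => ((√p.1 : ℝ) : ℂ)) p.2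

/-- The measure `s ^ (β - 1) ds dz` on `(0,∞) × ℂ^κ`. -/
noncomputable def gammaLebesgue (κ : Type*) [Fintype κ] (β : ℝ) : Measure (ℝ × (κ → ℂ)) :=
  ((volume.restrict (Set.Ioi 0)).withDensity fun s => ENNReal.ofReal (s ^ (β - 1))).prod volume

open Matrix in
theorem measurable_quadratic_sqrtVec {κ : Type*} [Fintype κ]
    (X : Matrix (Unit ⊕ κ) (Unit ⊕ κ) ℂ) :
    Measurable fun p => (star (sqrtVec p) ⬝ᵥ X *ᵥ sqrtVec p).re := by
  simp only [sqrtVec, dotProduct, mulVec, Fintype.sum_sum_type, Sum.elim_inl, Sum.elim_inr,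
    Pi.star_apply]
  refine Complex.measurable_re.comp (Continuous.measurable ?_)
  fun_prop

open Matrix in
theorem lintegral_gammaLebesgue {κ : Type*} [Fintype κ] [DecidableEq κ] {β : ℝ} (hβ : 0 < β)
    {X : Matrix (Unit ⊕ κ) (Unit ⊕ κ) ℂ} (hX : X.PosDef) :
    (∫⁻ p, ENNReal.ofReal (exp (-(star (sqrtVec p) ⬝ᵥ X *ᵥ sqrtVec p).re)) ∂gammaLebesgue κ β) *
        ENNReal.ofReal (X.toBlocks₂₂.det.re ^ (-(β - 1))) =
      ENNReal.ofReal (Gamma β) * complexGaussianMass κ * ENNReal.ofReal (X.det.re ^ (-β)) := by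
  obtain ⟨σ, hσ, c, hdet, hq⟩ := hX.exists_schur
  have hD : X.toBlocks₂₂.PosDef := hX.submatrix Sum.inr_injective
  have hDpos : 0 < X.toBlocks₂₂.det.re := (Complex.pos_iff.1 hD.det_pos).1
  have hm : Measurable fun p =>
      ENNReal.ofReal (exp (-(star (sqrtVec p) ⬝ᵥ X *ᵥ sqrtVec p).re)) :=
    (measurable_quadratic_sqrtVec X).neg.exp.ennreal_ofReal
  have hinner : ∀ s ∈ Set.Ioi (0 : ℝ), ∫⁻ z : κ → ℂ, ENNReal.ofReal
      (exp (-(star (sqrtVec (s, z)) ⬝ᵥ X *ᵥ sqrtVec (s, z)).re)) =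
        ENNReal.ofReal (exp (-(σ * s))) *
          (ENNReal.ofReal X.toBlocks₂₂.det.re⁻¹ * complexGaussianMass κ) := fun s hs => by
    rw [← lintegral_exp_neg_quadratic hD, ← lintegral_add_right_eq_self
      (fun z => ENNReal.ofReal (exp (-(star z ⬝ᵥ X.toBlocks₂₂ *ᵥ z).re))) (((√s : ℝ) : ℂ) • c),
      ← lintegral_const_mul' _ _ ENNReal.ofReal_ne_top]
    refine lintegral_congr fun z => ?_
    rw [← ENNReal.ofReal_mul (exp_pos _).le, ← exp_add, sqrtVec, hq, sq_sqrt (le_of_lt hs)]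
    ring_nf
  rw [gammaLebesgue, lintegral_prod _ hm.aemeasurable,
    lintegral_withDensity_eq_lintegral_mul _ (by fun_prop) hm.lintegral_prod_right',
    setLIntegral_congr_fun measurableSet_Ioi (g := fun s => (ENNReal.ofReal (s ^ (β - 1)) *
      ENNReal.ofReal (exp (-(σ * s)))) *
        (ENNReal.ofReal X.toBlocks₂₂.det.re⁻¹ * complexGaussianMass κ))
      (fun s hs => by simp only [Pi.mul_apply]; rw [hinner s hs, mul_assoc]),
    lintegral_mul_const _ (by fun_prop), lintegral_rpow_mul_exp_neg_mul_Ioi hβ hσ, hdet,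
    mul_rpow hDpos.le hσ.le, ENNReal.ofReal_mul (by positivity),
    show -β = -(β - 1) + -1 by ring, rpow_add hDpos, rpow_neg_one,
    ENNReal.ofReal_mul (by positivity)]
  ring

open Matrix in
theorem re_dotProduct_sum_smul_mulVec {ι κ : Type*} [Fintype ι] [Fintype κ]
    (A : ι → Matrix κ κ ℂ) (x : ι → ℝ) (v : κ → ℂ) :
    (star v ⬝ᵥ (∑ i, (x i : ℂ) • A i) *ᵥ v).re = ∑ i, x i * (star v ⬝ᵥ A i *ᵥ v).re := by
  simp [sum_mulVec, dotProduct_sum, smul_mulVec]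

open Matrix in
theorem exists_isLaplaceTransform_of_toBlocks₂₂ {ι κ : Type*} [Fintype ι] [Fintype κ]
    [DecidableEq κ] {A : ι → Matrix (Unit ⊕ κ) (Unit ⊕ κ) ℂ} (hA : ∀ i, (A i).PosSemidef)
    (hX : ∀ x ∈ posOrthant ι, (∑ i, (x i : ℂ) • A i).PosDef) {β : ℝ} (hβ : 0 < β)
    {μ : Measure (ι → ℝ)} [SFinite μ]
    (hμ : IsLaplaceTransform μ fun x =>
      (∑ i, (x i : ℂ) • (A i).toBlocks₂₂).det.re ^ (-(β - 1))) :
    ∃ ν : Measure (ι → ℝ), SFinite ν ∧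
      IsLaplaceTransform ν fun x => (∑ i, (x i : ℂ) • A i).det.re ^ (-β) := by
  let K := ENNReal.ofReal (Gamma β) * complexGaussianMass κ
  have hK0 : K ≠ 0 := mul_ne_zero (by simpa using Gamma_pos_of_pos hβ)
    (complexGaussianMass_ne_zero κ)
  have hKtop : K ≠ ⊤ := ENNReal.mul_ne_top ENNReal.ofReal_ne_top (complexGaussianMass_ne_top κ)
  let Q : ℝ × (κ → ℂ) → ι → ℝ := fun p i => (star (sqrtVec p) ⬝ᵥ A i *ᵥ sqrtVec p).re
  have hQ : Measurable Q := measurable_pi_lambda _ fun i => measurable_quadratic_sqrtVec (A i)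
  have hQt : Measurable fun y : (ℝ × (κ → ℂ)) × (ι → ℝ) => Q y.1 + y.2 := by fun_prop
  have : SFinite (gammaLebesgue κ β) := by unfold gammaLebesgue; infer_instance
  refine ⟨K⁻¹ • Measure.map (fun y => Q y.1 + y.2) ((gammaLebesgue κ β).prod μ),
    inferInstance, .of_lintegral ?_ (fun x hx => ?_) fun x hx => ?_⟩
  · refine Measure.ae_smul_measure ?_ _
    rw [ae_map_iff hQt.aemeasurable (by measurability)]
    have := Measure.quasiMeasurePreserving_snd (μ := gammaLebesgue κ β) (ν := μ) |>.ae hμ.1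
    filter_upwards [this] with y hy i
    exact add_nonneg ((hA i).re_dotProduct_nonneg _) (hy i)
  · exact rpow_nonneg (Complex.pos_iff.1 (hX x hx).det_pos).1.le _
  · have hblock : (∑ i, (x i : ℂ) • A i).toBlocks₂₂ = ∑ i, (x i : ℂ) • (A i).toBlocks₂₂ := by
      ext a b
      simp [toBlocks₂₂, Matrix.sum_apply]
    have hsplit : ∀ y : (ℝ × (κ → ℂ)) × (ι → ℝ), ENNReal.ofReal (exp (-(x ⬝ᵥ (Q y.1 + y.2)))) =
        ENNReal.ofReal (exp (-(star (sqrtVec y.1) ⬝ᵥ (∑ i, (x i : ℂ) • A i) *ᵥ sqrtVec y.1).re)) *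
          ENNReal.ofReal (exp (-(x ⬝ᵥ y.2))) := fun y => by
      rw [re_dotProduct_sum_smul_mulVec, ← ENNReal.ofReal_mul (exp_pos _).le, ← exp_add,
        dotProduct_add, neg_add]
      rfl
    have hm1 : Measurable fun p => ENNReal.ofReal
        (exp (-(star (sqrtVec p) ⬝ᵥ (∑ i, (x i : ℂ) • A i) *ᵥ sqrtVec p).re)) :=
      (measurable_quadratic_sqrtVec _).neg.exp.ennreal_ofReal
    have hm2 : Measurable fun t : ι → ℝ => ENNReal.ofReal (exp (-(x ⬝ᵥ t))) := by
      unfold dotProduct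
      fun_prop
    rw [lintegral_smul_measure, lintegral_map hm2 hQt]
    simp only [hsplit]
    rw [lintegral_prod_mul hm1.aemeasurable hm2.aemeasurable, hμ.lintegral_eq hx, ← hblock,
      lintegral_gammaLebesgue hβ (hX x hx), smul_eq_mul, ← mul_assoc,
      ENNReal.inv_mul_cancel hK0 hKtop, one_mul]

theorem exists_isLaplaceTransform_det_rpow {ι : Type*} [Fintype ι] {m : ℕ}
    {A : ι → Matrix (Fin m) (Fin m) ℂ} (hA : ∀ i, (A i).PosSemidef)
    (hX : ∀ x ∈ posOrthant ι, (∑ i, (x i : ℂ) • A i).PosDef) {β : ℝ}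
    (hβ : (∃ k : ℕ, β = k) ∨ (m : ℝ) - 1 ≤ β) :
    ∃ μ : Measure (ι → ℝ), SFinite μ ∧
      IsLaplaceTransform μ fun x => (∑ i, (x i : ℂ) • A i).det.re ^ (-β) := by
  induction m generalizing β with
  | zero =>
    exact ⟨_, inferInstance, by simpa using isLaplaceTransform_dirac_zero⟩
  | succ m ih =>
    push_cast at hβ
    have hβ0 : 0 ≤ β := by
      rcases hβ with ⟨k, rfl⟩ | h
      · positivity
      · have : (0 : ℝ) ≤ m := by positivity
        linarith
    rcases hβ0.eq_or_lt with rfl | hpos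
    · exact ⟨_, inferInstance, by simpa using isLaplaceTransform_dirac_zero⟩
    have hβ1 : (∃ k : ℕ, β - 1 = k) ∨ (m : ℝ) - 1 ≤ β - 1 := by
      rcases hβ with ⟨k, rfl⟩ | h
      · obtain ⟨j, rfl⟩ := Nat.exists_eq_succ_of_ne_zero (n := k) (by rintro rfl; simp at hpos)
        exact .inl ⟨j, by push_cast; ring⟩
      · exact .inr (by linarith)
    let e : Unit ⊕ Fin m ≃ Fin (m + 1) :=
      (Equiv.sumComm _ _).trans ((Equiv.optionEquivSumPUnit _).symm.trans (finSuccEquiv m).symm)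
    have hsub : ∀ x : ι → ℝ, ∑ i, (x i : ℂ) • (A i).submatrix e e =
        (∑ i, (x i : ℂ) • A i).submatrix e e := fun x => by
      ext a b
      simp [Matrix.sum_apply]
    have hXe : ∀ x ∈ posOrthant ι, (∑ i, (x i : ℂ) • (A i).submatrix e e).PosDef :=
      fun x hx => hsub x ▸ (hX x hx).submatrix e.injective
    obtain ⟨μ, hs, hμ⟩ := ih (A := fun i => ((A i).submatrix e e).toBlocks₂₂)
      (fun i => ((hA i).submatrix e).submatrix Sum.inr) (fun x hx => by
        convert (hXe x hx).submatrix Sum.inr_injective using 1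
        ext a b
        simp [Matrix.toBlocks₂₂, Matrix.sum_apply]) hβ1
    have := exists_isLaplaceTransform_of_toBlocks₂₂ (fun i => (hA i).submatrix e) hXe hpos hμ
    simpa only [hsub, Matrix.det_submatrix_equiv_self] using this

open Matrix in
theorem posDef_sum_smul_of_rank_eq {ι : Type*} [Fintype ι] {m : ℕ}
    {A : ι → Matrix (Fin m) (Fin m) ℂ} (hA : ∀ i, (A i).PosSemidef) {c : ι → ℝ}
    (hc : (∑ i, (c i : ℂ) • A i).rank = m) {x : ι → ℝ} (hx : x ∈ posOrthant ι) :
    (∑ i, (x i : ℂ) • A i).PosDef := by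
  have hpsd : (∑ i, (x i : ℂ) • A i).PosSemidef :=
    posSemidef_sum _ fun i _ => (hA i).smul (by exact_mod_cast (hx i).le)
  refine .of_dotProduct_mulVec_pos hpsd.isHermitian fun v hv => ?_
  refine (hpsd.dotProduct_mulVec_nonneg v).lt_of_ne' fun h0 => hv ?_
  have h1 := congrArg Complex.re h0
  rw [re_dotProduct_sum_smul_mulVec, Complex.zero_re, Finset.sum_eq_zero_iff_of_nonneg
    fun i _ => mul_nonneg (hx i).le
      (Complex.nonneg_iff.1 ((hA i).dotProduct_mulVec_nonneg v)).1] at h1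
  have h2 : ∀ i, A i *ᵥ v = 0 := fun i => by
    rw [← (hA i).dotProduct_mulVec_zero_iff]
    have h3 := (mul_eq_zero.1 (h1 i (Finset.mem_univ i))).resolve_left (hx i).ne'
    exact Complex.ext h3 (Complex.nonneg_iff.1 ((hA i).dotProduct_mulVec_nonneg v)).2.symm
  have hsurj : Function.Surjective (∑ i, (c i : ℂ) • A i).mulVecLin := by
    rw [← LinearMap.range_eq_top]
    exact Submodule.eq_top_of_finrank_eq (hc.trans (by simp))
  refine LinearMap.injective_iff_surjective.2 hsurj ?_
  simp [h2]

/-- Let `A_1, …, A_n` (`n ≥ 1`) be complex hermitian positive-semidefinite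
`m×m` matrices such that some real linear combination of them has rank `m`, and for real
`x_1, …, x_n` let `P(x) = det (∑ i, x_i A_i)`, which is a real number.  Then `P > 0` on
`(0,∞)^n`, and `P^{-β}` is completely monotone on `(0,∞)^n` for every `β ∈ {0, 1, 2, 3, …}`
and every real `β ≥ m−1`. -/
theorem inverse_power_det_complex_hermitian_completely_monotone
    {n m : ℕ} (hn : 1 ≤ n) (A : Fin n → Matrix (Fin m) (Fin m) ℂ)
    (hpsd : ∀ i, (A i).PosSemidef)
    (hrank : ∃ c : Fin n → ℝ, (∑ i, (c i : ℂ) • A i).rank = m)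
    (β : ℝ) (hβ : (∃ k : ℕ, β = (k : ℝ)) ∨ (m : ℝ) - 1 ≤ β) :
    (∀ x : Fin n → ℝ, ((∑ i, (x i : ℂ) • A i).det).im = 0) ∧
    (∀ x ∈ posOrthant (Fin n), 0 < ((∑ i, (x i : ℂ) • A i).det).re) ∧
      CompletelyMonotoneOnOrthant
        (fun x : Fin n → ℝ => ((∑ i, (x i : ℂ) • A i).det).re ^ (-β)) := by

  obtain ⟨c, hc⟩ := hrank
  have hX := fun x (hx : x ∈ posOrthant (Fin n)) => posDef_sum_smul_of_rank_eq hpsd hc hx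
  refine ⟨fun x => ?_, fun x hx => (Complex.pos_iff.1 (hX x hx).det_pos).1, ?_⟩
  · have hH : (∑ i, (x i : ℂ) • A i).IsHermitian := by
      rw [Matrix.IsHermitian, Matrix.conjTranspose_sum]
      refine Finset.sum_congr rfl fun i _ => ?_
      rw [Matrix.conjTranspose_smul, (hpsd i).isHermitian.eq]
      simp
    rw [← Complex.conj_eq_iff_im, starRingEnd_apply, ← Matrix.det_conjTranspose, hH.eq]
  · obtain ⟨μ, -, hμ⟩ := exists_isLaplaceTransform_det_rpow hpsd hX hβ
    exact hμ.completelyMonotone
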